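/- arXiv:math/0311400 — 9 statements merged into one kernel-verified Lean document; each statement's English description precedes it below -/
import Mathlib

section
/- Let γ ≠ 0 and δ ∉ {0, 1} be real scalars. Let e, f ∈ B be idempotents, each of central charge γ and each having the fusion property of binary type with respect to δ, such that f ∈ B^e(0) ⊕ B^e(δ) ⊕ ℂe and e ∈ B^f(0) ⊕ B^f(δ) ⊕ ℂf. Then either (e|f) = δγ/8, or both f_e(δ) = 0 and e_f(δ) = 0. -/
variable {B : Type*} [AddCommGroup B] [Module ℂ B]

/-- The eigenspace `B^e(h) = {v ∈ B : (e|v) = 0 and e·v = h·v}`. -/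
def eigSp (mul : B →ₗ[ℂ] B →ₗ[ℂ] B) (form : B →ₗ[ℂ] B →ₗ[ℂ] ℂ) (e : B) (h : ℂ) :
    Submodule ℂ B where
  carrier := {v | form e v = 0 ∧ mul e v = h • v}
  add_mem' := by
    intro a b ha hb
    exact ⟨by rw [map_add, ha.1, hb.1, add_zero], by rw [map_add, ha.2, hb.2, smul_add]⟩
  zero_mem' := ⟨by simp, by simp⟩
  smul_mem' := by
    intro c a ha
    exact ⟨by rw [map_smul, ha.1, smul_zero], by rw [map_smul, ha.2, smul_comm]⟩

/-- The subspace `B_e[0] = B^e(0) ⊕ ℂe`. -/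
def beBar (mul : B →ₗ[ℂ] B →ₗ[ℂ] B) (form : B →ₗ[ℂ] B →ₗ[ℂ] ℂ) (e : B) : Submodule ℂ B :=
  eigSp mul form e 0 ⊔ Submodule.span ℂ {e}

/-- The fusion property of binary type of the idempotent `e` with respect to the
spectrum `δ`: writing `B_e[0] = B^e(0) ⊕ ℂe` and `B_e[1] = B^e(δ)`, one has
`B_e[ε₁]·B_e[ε₂] ⊆ B_e[ε₁+ε₂]`. -/
def HasFusion (mul : B →ₗ[ℂ] B →ₗ[ℂ] B) (form : B →ₗ[ℂ] B →ₗ[ℂ] ℂ) (e : B) (δ : ℂ) : Prop :=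
  (∀ x ∈ beBar mul form e, ∀ y ∈ beBar mul form e, mul x y ∈ beBar mul form e) ∧
  (∀ x ∈ beBar mul form e, ∀ y ∈ eigSp mul form e δ, mul x y ∈ eigSp mul form e δ) ∧
  (∀ x ∈ eigSp mul form e δ, ∀ y ∈ beBar mul form e, mul x y ∈ eigSp mul form e δ) ∧
  (∀ x ∈ eigSp mul form e δ, ∀ y ∈ eigSp mul form e δ, mul x y ∈ beBar mul form e)

/-- `B_e[0]` and `B_e[1] = B^e(δ)` meet trivially when `δ ≠ 0` and `(e|e) ≠ 0`. -/
theorem eq_zero_of_mem_eigSp_of_mem_beBar {B : Type*} [AddCommGroup B] [Module ℂ B]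
    {mul : B →ₗ[ℂ] B →ₗ[ℂ] B} {form : B →ₗ[ℂ] B →ₗ[ℂ] ℂ} {δ : ℂ} (hδ0 : δ ≠ 0)
    {e x : B} (hee : form e e ≠ 0)
    (hx : x ∈ eigSp mul form e δ) (hx' : x ∈ beBar mul form e) : x = 0 := by
  obtain ⟨z, hz, w, hw, rfl⟩ := Submodule.mem_sup.1 hx'
  obtain ⟨k, rfl⟩ := Submodule.mem_span_singleton.1 hw
  have h1 := hx.1
  rw [map_add, hz.1, map_smul, zero_add, smul_eq_mul] at h1
  have hk : k = 0 := (mul_eq_zero.1 h1).resolve_right hee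
  subst hk
  have h2 := hx.2
  rw [zero_smul, add_zero, hz.2, zero_smul] at h2
  rw [zero_smul, add_zero]
  exact (smul_eq_zero.1 h2.symm).resolve_left hδ0

/-- The `e`-coefficient of an element of `B^e(0) ⊕ B^e(δ) ⊕ ℂe` is read off by the form. -/
theorem form_eq_of_decomposition {B : Type*} [AddCommGroup B] [Module ℂ B]
    {mul : B →ₗ[ℂ] B →ₗ[ℂ] B} {form : B →ₗ[ℂ] B →ₗ[ℂ] ℂ} {δ : ℂ} {e f f₀ fδ : B} {c : ℂ}
    (hf₀ : f₀ ∈ eigSp mul form e 0) (hfδ : fδ ∈ eigSp mul form e δ)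
    (hfdec : f = f₀ + fδ + c • e) : form e f = c * form e e := by
  rw [hfdec, map_add, map_add, hf₀.1, hfδ.1, map_smul, smul_eq_mul, zero_add, zero_add]

/-- Multiplication of an element of `B^e(0) ⊕ B^e(δ) ⊕ ℂe` by the idempotent `e`. -/
theorem mul_eq_of_decomposition {B : Type*} [AddCommGroup B] [Module ℂ B]
    {mul : B →ₗ[ℂ] B →ₗ[ℂ] B} {form : B →ₗ[ℂ] B →ₗ[ℂ] ℂ} {δ : ℂ} {e f f₀ fδ : B} {c : ℂ}
    (he : mul e e = (2 : ℂ) • e)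
    (hf₀ : f₀ ∈ eigSp mul form e 0) (hfδ : fδ ∈ eigSp mul form e δ)
    (hfdec : f = f₀ + fδ + c • e) : mul e f = δ • fδ + (2 * c) • e := by
  rw [hfdec, map_add, map_add, hf₀.2, hfδ.2, map_smul, he]
  module

/-- If `e` has the fusion property and `f` is an idempotent whose `δ`-component relative to `e` is
`fδ`, then `fδ = 0` unless the common coefficient `c` equals `δ / 4`. -/
theorem deltaComponent_eq_zero_of_fusion {B : Type*} [AddCommGroup B] [Module ℂ B]
    {mul : B →ₗ[ℂ] B →ₗ[ℂ] B} (hcomm : ∀ x y : B, mul x y = mul y x)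
    {form : B →ₗ[ℂ] B →ₗ[ℂ] ℂ} {δ : ℂ} (hδ0 : δ ≠ 0) (hδ1 : δ ≠ 1)
    {e f : B} (hee : form e e ≠ 0)
    (he : mul e e = (2 : ℂ) • e) (hf : mul f f = (2 : ℂ) • f)
    (hfuse : HasFusion mul form e δ)
    {f₀ fδ e₀ eδ : B} {c : ℂ} (hc : 4 * c ≠ δ)
    (hf₀ : f₀ ∈ eigSp mul form e 0) (hfδ : fδ ∈ eigSp mul form e δ)
    (hfdec : f = f₀ + fδ + c • e)
    (he₀ : e₀ ∈ eigSp mul form f 0) (heδ : eδ ∈ eigSp mul form f δ)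
    (hedec : e = e₀ + eδ + c • f) : fδ = 0 := by
  obtain ⟨h00, h01, -, h11⟩ := hfuse
  have hf₀' : f₀ ∈ beBar mul form e := Submodule.mem_sup_left hf₀
  have he' : e ∈ beBar mul form e :=
    Submodule.mem_sup_right (Submodule.mem_span_singleton_self e)
  have hef := mul_eq_of_decomposition he hf₀ hfδ hfdec
  have hfe := mul_eq_of_decomposition hf he₀ heδ hedec
  have hff : mul f f = mul f₀ f₀ + (2 : ℂ) • mul f₀ fδ + mul fδ fδ
      + (2 * c * δ) • fδ + (2 * c ^ 2) • e := by
    rw [hfdec]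
    simp only [map_add, map_smul, LinearMap.add_apply, LinearMap.smul_apply, hcomm fδ f₀,
      hcomm f₀ e, hcomm fδ e, hf₀.2, hfδ.2, he]
    module
  have hmix : mul f₀ fδ = (1 - c * δ) • fδ := by
    have hmem : (2 : ℂ) • (mul f₀ fδ - (1 - c * δ) • fδ) ∈ eigSp mul form e δ :=
      Submodule.smul_mem _ _ (Submodule.sub_mem _ (h01 _ hf₀' _ hfδ) (Submodule.smul_mem _ _ hfδ))
    have heq : (2 : ℂ) • (mul f₀ fδ - (1 - c * δ) • fδ)
        = (2 : ℂ) • f₀ + (2 * c - 2 * c ^ 2) • e - mul f₀ f₀ - mul fδ fδ := by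
      rw [hf, hfdec] at hff
      linear_combination (norm := module) -hff
    have hzero := eq_zero_of_mem_eigSp_of_mem_beBar hδ0 hee hmem (by
      rw [heq]
      exact Submodule.sub_mem _ (Submodule.sub_mem _ (Submodule.add_mem _
        (Submodule.smul_mem _ _ hf₀') (Submodule.smul_mem _ _ he')) (h00 _ hf₀' _ hf₀'))
        (h11 _ hfδ _ hfδ))
    exact sub_eq_zero.1 ((smul_eq_zero.1 hzero).resolve_left two_ne_zero)
  have hffδ : mul f fδ = fδ + mul fδ fδ := by
    rw [hfdec]
    simp only [map_add, map_smul, LinearMap.add_apply, LinearMap.smul_apply, hmix, hfδ.2]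
    module
  have heδ' : δ • eδ = δ • fδ + (2 * c) • e - (2 * c) • f := by
    rw [← hef, hcomm e f, hfe]
    module
  have hkey : δ • (fδ + mul fδ fδ) + (2 * c) • (δ • fδ + (2 * c) • e) - (2 * c) • (2 : ℂ) • f
      = δ • (δ • fδ + (2 * c) • e - (2 * c) • f) := by
    have h := congrArg (mul f) heδ'
    rw [map_smul, heδ.2, heδ', map_sub, map_add, map_smul, map_smul, map_smul, hffδ, hcomm f e,
      hef, hf] at h
    exact h.symm
  have heq : ((1 - δ) * (δ - 4 * c)) • fδ
      = (4 * c - 2 * c * δ) • f₀ + (2 * c * δ - 2 * c ^ 2 * δ) • e - δ • mul fδ fδ := by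
    rw [hfdec] at hkey
    linear_combination (norm := module) hkey
  have hzero := eq_zero_of_mem_eigSp_of_mem_beBar hδ0 hee (Submodule.smul_mem _ _ hfδ) (by
    rw [heq]
    exact Submodule.sub_mem _ (Submodule.add_mem _ (Submodule.smul_mem _ _ hf₀')
      (Submodule.smul_mem _ _ he')) (Submodule.smul_mem _ _ (h11 _ hfδ _ hfδ)))
  exact (smul_eq_zero.1 hzero).resolve_left
    (mul_ne_zero (sub_ne_zero.2 hδ1.symm) (sub_ne_zero.2 hc.symm))

/-- Let `γ ≠ 0` and `δ ∉ {0,1}` be real scalars, and let `e, f` be idempotents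
of central charge `γ`, each with the fusion property of binary type with respect to `δ`,
with `f ∈ B^e(0) ⊕ B^e(δ) ⊕ ℂe` and `e ∈ B^f(0) ⊕ B^f(δ) ⊕ ℂf`.  Then either
`(e|f) = δγ/8` or `f_e(δ) = 0` and `e_f(δ) = 0`. -/
theorem stmt_1 {B : Type*} [AddCommGroup B] [Module ℂ B]
    (mul : B →ₗ[ℂ] B →ₗ[ℂ] B) (hcomm : ∀ x y : B, mul x y = mul y x)
    (form : B →ₗ[ℂ] B →ₗ[ℂ] ℂ) (hsymm : ∀ x y : B, form x y = form y x)
    (hinv : ∀ a x y : B, form (mul a x) y = form x (mul a y))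
    (γ δ : ℝ) (hγ : γ ≠ 0) (hδ0 : δ ≠ 0) (hδ1 : δ ≠ 1)
    (e f : B)
    (he : mul e e = (2 : ℂ) • e) (hcce : 2 * form e e = (γ : ℂ))
    (hf : mul f f = (2 : ℂ) • f) (hccf : 2 * form f f = (γ : ℂ))
    (hfuse : HasFusion mul form e (δ : ℂ)) (hfusf : HasFusion mul form f (δ : ℂ))
    (f₀ fδ : B) (cf : ℂ)
    (hf₀ : f₀ ∈ eigSp mul form e 0) (hfδ : fδ ∈ eigSp mul form e (δ : ℂ))
    (hfdec : f = f₀ + fδ + cf • e)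
    (e₀ eδ : B) (ce : ℂ)
    (he₀ : e₀ ∈ eigSp mul form f 0) (heδ : eδ ∈ eigSp mul form f (δ : ℂ))
    (hedec : e = e₀ + eδ + ce • f) :
    form e f = ((δ * γ / 8 : ℝ) : ℂ) ∨ (fδ = 0 ∧ eδ = 0) := by
  have hγ' : (γ : ℂ) ≠ 0 := Complex.ofReal_ne_zero.2 hγ
  have hee : form e e ≠ 0 := fun h => hγ' (by rw [← hcce, h, mul_zero])
  have hff : form f f ≠ 0 := fun h => hγ' (by rw [← hccf, h, mul_zero])
  have hef := form_eq_of_decomposition hf₀ hfδ hfdec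
  have hfe := form_eq_of_decomposition he₀ heδ hedec
  obtain rfl : cf = ce := by
    refine mul_right_cancel₀ hγ' ?_
    linear_combination -cf * hcce + ce * hccf - 2 * hef + 2 * hfe + 2 * hsymm e f
  have hδ0' : (δ : ℂ) ≠ 0 := Complex.ofReal_ne_zero.2 hδ0
  have hδ1' : (δ : ℂ) ≠ 1 := Complex.ofReal_ne_one.2 hδ1
  by_cases hc : 4 * cf = (δ : ℂ)
  · left
    push_cast
    linear_combination hef + cf / 2 * hcce + γ / 8 * hc
  · exact .inr
      ⟨deltaComponent_eq_zero_of_fusion hcomm hδ0' hδ1' hee he hf hfuse hc hf₀ hfδ hfdec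
        he₀ heδ hedec,
      deltaComponent_eq_zero_of_fusion hcomm hδ0' hδ1' hff hf he hfusf hc he₀ heδ hedec
        hf₀ hfδ hfdec⟩
end

section
/- Let γ ≠ 0 and δ ≠ 0 be scalars. Let e, f ∈ B be idempotents, each of central charge γ, such that f ∈ B^e(0) ⊕ B^e(δ) ⊕ ℂe and e ∈ B^f(0) ⊕ B^f(δ) ⊕ ℂf. Then ((8/(δγ))·(e|f) − 1)·(e − f) = σ_e(f) − σ_f(e). -/
variable {B : Type*} [AddCommGroup B] [Module ℂ B]

/-- If `x = x₀ + xδ + c • e` with `x₀ ∈ B^e(0)` and `xδ ∈ B^e(δ)` for an idempotent `e` of nonzero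
central charge `γ`, then `δ • xδ = e · x - (4 (e|x) / γ) • e`. -/
theorem smul_component_eq {B : Type*} [AddCommGroup B] [Module ℂ B]
    (mul : B →ₗ[ℂ] B →ₗ[ℂ] B) (form : B →ₗ[ℂ] B →ₗ[ℂ] ℂ)
    {γ δ : ℂ} (hγ : γ ≠ 0) {e : B} (he : mul e e = (2 : ℂ) • e) (hcc : 2 * form e e = γ)
    {x x₀ xδ : B} {c : ℂ} (hx₀ : x₀ ∈ eigSp mul form e 0) (hxδ : xδ ∈ eigSp mul form e δ)
    (hx : x = x₀ + xδ + c • e) :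
    δ • xδ = mul e x - (4 * form e x / γ) • e := by
  obtain ⟨hf₀, hm₀⟩ := hx₀
  obtain ⟨hfδ, hmδ⟩ := hxδ
  have hform : form e x = c * form e e := by
    rw [hx, map_add, map_add, map_smul, hf₀, hfδ, smul_eq_mul, zero_add, zero_add]
  have hcoef : 4 * form e x / γ = c * 2 := by
    rw [div_eq_iff hγ, hform]
    linear_combination 2 * c * hcc
  rw [hcoef, hx, map_add, map_add, map_smul, hm₀, hmδ, he, zero_smul, smul_smul]
  abel

/-- Let `γ ≠ 0` and `δ ≠ 0` be scalars, and `e, f` idempotents of central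
charge `γ` with `f ∈ B^e(0) ⊕ B^e(δ) ⊕ ℂe` and `e ∈ B^f(0) ⊕ B^f(δ) ⊕ ℂf`.  Then
`((8/(δγ))·(e|f) − 1)·(e − f) = σ_e(f) − σ_f(e)`, where `σ_e(f) = f − 2·f_e(δ)` and
`σ_f(e) = e − 2·e_f(δ)`. -/
theorem stmt_3 {B : Type*} [AddCommGroup B] [Module ℂ B]
    (mul : B →ₗ[ℂ] B →ₗ[ℂ] B) (hcomm : ∀ x y : B, mul x y = mul y x)
    (form : B →ₗ[ℂ] B →ₗ[ℂ] ℂ) (hsymm : ∀ x y : B, form x y = form y x)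
    (hinv : ∀ a x y : B, form (mul a x) y = form x (mul a y))
    (γ δ : ℂ) (hγ : γ ≠ 0) (hδ : δ ≠ 0)
    (e f : B)
    (he : mul e e = (2 : ℂ) • e) (hcce : 2 * form e e = γ)
    (hf : mul f f = (2 : ℂ) • f) (hccf : 2 * form f f = γ)
    (f₀ fδ : B) (cf : ℂ)
    (hf₀ : f₀ ∈ eigSp mul form e 0) (hfδ : fδ ∈ eigSp mul form e δ)
    (hfdec : f = f₀ + fδ + cf • e)
    (e₀ eδ : B) (ce : ℂ)
    (he₀ : e₀ ∈ eigSp mul form f 0) (heδ : eδ ∈ eigSp mul form f δ)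
    (hedec : e = e₀ + eδ + ce • f) :
    ((8 / (δ * γ)) * form e f - 1) • (e - f) = (f - (2 : ℂ) • fδ) - (e - (2 : ℂ) • eδ) := by
  have h₁ := smul_component_eq mul form hγ he hcce hf₀ hfδ hfdec
  have h₂ := smul_component_eq mul form hγ hf hccf he₀ heδ hedec
  rw [hcomm f e, hsymm f e] at h₂
  have hfδ' : fδ = δ⁻¹ • (mul e f - (4 * form e f / γ) • e) := by
    rw [← h₁, inv_smul_smul₀ hδ]
  have heδ' : eδ = δ⁻¹ • (mul e f - (4 * form e f / γ) • f) := by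
    rw [← h₂, inv_smul_smul₀ hδ]
  rw [hfδ', heδ']
  match_scalars <;> field_simp <;> ring
end

section
/- Let γ ≠ 0 and δ ≠ 0 be scalars, and let e ∈ B be an idempotent of central charge γ having the fusion property of binary type with respect to δ and such that B = B^e(0) ⊕ B^e(δ) ⊕ ℂe. Let σ_e : B → B be the linear map acting as the identity on B_e[0] = B^e(0) ⊕ ℂe and as −1 on B_e[1] = B^e(δ). Then σ_e is an automorphism of the algebra B that preserves the bilinear form: σ_e(x·y) = σ_e(x)·σ_e(y) and (σ_e(x)|σ_e(y)) = (x|y) for all x, y ∈ B. -/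
variable {B : Type*} [AddCommGroup B] [Module ℂ B]

/-- Eigenvectors of multiplication by `e` with nonzero eigenvalue `δ` are orthogonal to
`B^e(0) ⊕ ℂe`. -/
theorem form_eq_zero_of_mem_beBar_of_mem_eigSp {mul : B →ₗ[ℂ] B →ₗ[ℂ] B}
    {form : B →ₗ[ℂ] B →ₗ[ℂ] ℂ} (hinv : ∀ a x y : B, form (mul a x) y = form x (mul a y))
    {e : B} {δ : ℂ} (hδ : δ ≠ 0) {x y : B} (hx : x ∈ beBar mul form e)
    (hy : y ∈ eigSp mul form e δ) : form x y = 0 := by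
  obtain ⟨a, ha, b, hb, rfl⟩ := Submodule.mem_sup.mp hx
  obtain ⟨c, rfl⟩ := Submodule.mem_span_singleton.mp hb
  have h := hinv e a y
  rw [ha.2, hy.2, zero_smul, map_zero, LinearMap.zero_apply, map_smul, smul_eq_mul] at h
  have hay : form a y = 0 := (mul_eq_zero.mp h.symm).resolve_left hδ
  simp [hay, hy.1]

/-- Let `γ ≠ 0`, `δ ≠ 0` be scalars and `e` an idempotent of central charge
`γ` with the fusion property of binary type with respect to `δ`, such that
`B = B^e(0) ⊕ B^e(δ) ⊕ ℂe`.  Let `σ_e` be the linear map acting as the identity on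
`B_e[0] = B^e(0) ⊕ ℂe` and as `−1` on `B_e[1] = B^e(δ)`.  Then `σ_e` is an automorphism of
the algebra `B` preserving the bilinear form: `σ_e(x·y) = σ_e(x)·σ_e(y)` and
`(σ_e(x)|σ_e(y)) = (x|y)` for all `x, y`. -/
theorem stmt_5 {B : Type*} [AddCommGroup B] [Module ℂ B]
    (mul : B →ₗ[ℂ] B →ₗ[ℂ] B) (hcomm : ∀ x y : B, mul x y = mul y x)
    (form : B →ₗ[ℂ] B →ₗ[ℂ] ℂ) (hsymm : ∀ x y : B, form x y = form y x)
    (hinv : ∀ a x y : B, form (mul a x) y = form x (mul a y))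
    (γ δ : ℂ) (hγ : γ ≠ 0) (hδ : δ ≠ 0)
    (e : B) (he : mul e e = (2 : ℂ) • e) (hcc : 2 * form e e = γ)
    (hfus : HasFusion mul form e δ)
    (hdec : eigSp mul form e 0 ⊔ eigSp mul form e δ ⊔ Submodule.span ℂ {e} = ⊤)
    (σ : B →ₗ[ℂ] B)
    (hσ0 : ∀ x ∈ beBar mul form e, σ x = x)
    (hσ1 : ∀ x ∈ eigSp mul form e δ, σ x = -x) :
    Function.Bijective σ ∧
    (∀ x y : B, σ (mul x y) = mul (σ x) (σ y)) ∧
    (∀ x y : B, form (σ x) (σ y) = form x y) := by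
  obtain ⟨h00, h01, h10, h11⟩ := hfus
  have hsum : ∀ x : B, ∃ a ∈ beBar mul form e, ∃ b ∈ eigSp mul form e δ, a + b = x := by
    intro x
    rw [← Submodule.mem_sup, beBar, sup_right_comm, hdec]
    exact Submodule.mem_top
  have hσ : ∀ a ∈ beBar mul form e, ∀ b ∈ eigSp mul form e δ, σ (a + b) = a - b := by
    intro a ha b hb
    rw [map_add, hσ0 a ha, hσ1 b hb, sub_eq_add_neg]
  refine ⟨Function.Involutive.bijective fun x => ?_, fun x y => ?_, fun x y => ?_⟩
  · obtain ⟨a, ha, b, hb, rfl⟩ := hsum x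
    rw [hσ a ha b hb, map_sub, hσ0 a ha, hσ1 b hb, sub_neg_eq_add]
  · obtain ⟨a, ha, b, hb, rfl⟩ := hsum x
    obtain ⟨c, hc, d, hd, rfl⟩ := hsum y
    rw [hσ a ha b hb, hσ c hc d hd]
    simp only [map_add, map_sub, LinearMap.add_apply, LinearMap.sub_apply,
      hσ0 _ (h00 a ha c hc), hσ1 _ (h01 a ha d hd), hσ1 _ (h10 b hb c hc),
      hσ0 _ (h11 b hb d hd)]
    abel
  · obtain ⟨a, ha, b, hb, rfl⟩ := hsum x
    obtain ⟨c, hc, d, hd, rfl⟩ := hsum y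
    have had : form a d = 0 := form_eq_zero_of_mem_beBar_of_mem_eigSp hinv hδ ha hd
    have hbc : form b c = 0 :=
      (hsymm b c).trans (form_eq_zero_of_mem_beBar_of_mem_eigSp hinv hδ hc hb)
    rw [hσ a ha b hb, hσ c hc d hd]
    simp [had, hbc]
end

section
/- For any two elements e, f ∈ E, the automorphisms σ_e and σ_f of B satisfy: σ_e σ_f has order 1, 2 or 3; more precisely, if e = f then σ_e σ_f = id, if (e|f) = 0 then (σ_e σ_f)² = id, and if (e|f) = δγ/8 then (σ_e σ_f)³ = id. Consequently the pair (G, D), where D = {σ_e : e ∈ E} and G = ⟨D⟩ inside the group of form-preserving algebra automorphisms of B, is a 3-transposition group. -/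
variable {B : Type*} [AddCommGroup B] [Module ℂ B]

/-- `σ` is the involution `σ_e` attached to the idempotent `e`: it is the identity on
`B_e[0] = B^e(0) ⊕ ℂe` and `−1` on `B_e[1] = B^e(δ)`; it is then a form-preserving algebra
automorphism of `B`. -/
def IsSigma (mul : B →ₗ[ℂ] B →ₗ[ℂ] B) (form : B →ₗ[ℂ] B →ₗ[ℂ] ℂ) (δ : ℂ) (e : B)
    (σ : B ≃ₗ[ℂ] B) : Prop :=
  (∀ x ∈ beBar mul form e, σ x = x) ∧
  (∀ x ∈ eigSp mul form e δ, σ x = -x) ∧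
  (∀ x y : B, σ (mul x y) = mul (σ x) (σ y)) ∧
  (∀ x y : B, form (σ x) (σ y) = form x y)

/-- `e ∈ E`: `e` is an idempotent of central charge `γ` such that
`B = B^e(0) ⊕ B^e(δ) ⊕ ℂe` and `e` has the fusion property of binary type w.r.t. `δ`. -/
def memE (mul : B →ₗ[ℂ] B →ₗ[ℂ] B) (form : B →ₗ[ℂ] B →ₗ[ℂ] ℂ) (γ δ : ℝ) (e : B) : Prop :=
  mul e e = (2 : ℂ) • e ∧ 2 * form e e = (γ : ℂ) ∧
  HasFusion mul form e (δ : ℂ) ∧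
  eigSp mul form e 0 ⊔ eigSp mul form e (δ : ℂ) ⊔ Submodule.span ℂ {e} = ⊤

/-- The set `D = {σ_e : e ∈ E}` inside the group of (form-preserving algebra)
automorphisms of `B`. -/
def setD (mul : B →ₗ[ℂ] B →ₗ[ℂ] B) (form : B →ₗ[ℂ] B →ₗ[ℂ] ℂ) (γ δ : ℝ) :
    Set (B ≃ₗ[ℂ] B) :=
  {σ | ∃ e : B, memE mul form γ δ e ∧ IsSigma mul form (δ : ℂ) e σ}

/-- A linear automorphism of `B` preserving the product and the form. -/
def PreservesStructure (mul : B →ₗ[ℂ] B →ₗ[ℂ] B) (form : B →ₗ[ℂ] B →ₗ[ℂ] ℂ)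
    (g : B ≃ₗ[ℂ] B) : Prop :=
  (∀ x y : B, g (mul x y) = mul (g x) (g y)) ∧ ∀ x y : B, form (g x) (g y) = form x y

section

variable {mul : B →ₗ[ℂ] B →ₗ[ℂ] B} {form : B →ₗ[ℂ] B →ₗ[ℂ] ℂ} {γ δ : ℝ} {e f : B}

theorem PreservesStructure.inv {g : B ≃ₗ[ℂ] B} (hg : PreservesStructure mul form g) :
    PreservesStructure mul form g⁻¹ := by
  have h : ∀ x, g (g⁻¹ x) = x := g.apply_symm_apply
  refine ⟨fun x y => g.injective ?_, fun x y => ?_⟩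
  · rw [hg.1, h, h, h]
  · rw [← hg.2, h, h]

theorem preservesStructure_of_mem_closure {g : B ≃ₗ[ℂ] B}
    (hg : g ∈ Subgroup.closure (setD mul form γ δ)) : PreservesStructure mul form g := by
  induction hg using Subgroup.closure_induction with
  | mem x hx =>
    obtain ⟨_, _, h⟩ := hx
    exact h.2.2
  | one => exact ⟨fun _ _ => rfl, fun _ _ => rfl⟩
  | mul x y _ _ hx hy =>
    exact ⟨fun a b => by simp only [LinearEquiv.mul_apply, hy.1, hx.1],
      fun a b => by simp only [LinearEquiv.mul_apply, hy.2, hx.2]⟩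
  | inv x _ hx => exact hx.inv

theorem PreservesStructure.map_mem_eigSp_iff {g : B ≃ₗ[ℂ] B}
    (hg : PreservesStructure mul form g) {h : ℂ} {v : B} :
    g v ∈ eigSp mul form (g e) h ↔ v ∈ eigSp mul form e h := by
  change form (g e) (g v) = 0 ∧ mul (g e) (g v) = h • g v ↔ form e v = 0 ∧ mul e v = h • v
  rw [hg.2, ← hg.1, ← map_smul, g.injective.eq_iff]

theorem PreservesStructure.map_eigSp {g : B ≃ₗ[ℂ] B} (hg : PreservesStructure mul form g)
    (e : B) (h : ℂ) :
    (eigSp mul form e h).map (g : B →ₗ[ℂ] B) = eigSp mul form (g e) h := by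
  ext v
  obtain ⟨w, rfl⟩ := g.surjective v
  rw [hg.map_mem_eigSp_iff]
  exact g.injective.mem_set_image

theorem PreservesStructure.map_beBar {g : B ≃ₗ[ℂ] B} (hg : PreservesStructure mul form g)
    (e : B) : (beBar mul form e).map (g : B →ₗ[ℂ] B) = beBar mul form (g e) := by
  rw [beBar, beBar, Submodule.map_sup, hg.map_eigSp, Submodule.map_span, Set.image_singleton]
  rfl

theorem PreservesStructure.map_memE {g : B ≃ₗ[ℂ] B} (hg : PreservesStructure mul form g)
    (he : memE mul form γ δ e) : memE mul form γ δ (g e) := by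
  obtain ⟨h1, h2, ⟨h3, h4, h5, h6⟩, h7⟩ := he
  refine ⟨by rw [← hg.1, h1, map_smul], by rw [hg.2, h2], ?_, ?_⟩
  · rw [HasFusion, ← hg.map_beBar, ← hg.map_eigSp]
    refine ⟨?_, ?_, ?_, ?_⟩ <;> rintro _ ⟨x, hx, rfl⟩ _ ⟨y, hy, rfl⟩ <;>
      rw [LinearEquiv.coe_coe, ← hg.1] <;> apply Submodule.mem_map_of_mem
    exacts [h3 x hx y hy, h4 x hx y hy, h5 x hx y hy, h6 x hx y hy]
  · have := congrArg (Submodule.map (g : B →ₗ[ℂ] B)) h7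
    rw [Submodule.map_sup, Submodule.map_sup, hg.map_eigSp, hg.map_eigSp, Submodule.map_span,
      Set.image_singleton, Submodule.map_top, LinearEquiv.range] at this
    exact this

theorem IsSigma.conj {σ g : B ≃ₗ[ℂ] B} (hg : PreservesStructure mul form g)
    (hσ : IsSigma mul form (δ : ℂ) e σ) :
    IsSigma mul form (δ : ℂ) (g e) (g * σ * g⁻¹) := by
  have hinv := hg.inv
  have hsymm : ∀ x, g⁻¹ (g x) = x := g.symm_apply_apply
  obtain ⟨h1, h2, h3, h4⟩ := hσ
  refine ⟨?_, ?_, fun x y => ?_, fun x y => ?_⟩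
  · rw [← hg.map_beBar]
    rintro _ ⟨x, hx, rfl⟩
    simp only [LinearEquiv.mul_apply, LinearEquiv.coe_coe, hsymm, h1 x hx]
  · rw [← hg.map_eigSp]
    rintro _ ⟨x, hx, rfl⟩
    simp only [LinearEquiv.mul_apply, LinearEquiv.coe_coe, hsymm, h2 x hx, map_neg]
  · simp only [LinearEquiv.mul_apply, hinv.1, h3, hg.1]
  · simp only [LinearEquiv.mul_apply, hg.2, h4, hinv.2]

theorem memE.exists_decomp (he : memE mul form γ δ e) (v : B) :
    ∃ c : ℂ, ∃ v₀ ∈ eigSp mul form e 0, ∃ v₁ ∈ eigSp mul form e (δ : ℂ),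
      v = c • e + v₀ + v₁ ∧ 2 * form e v = c * γ := by
  have hv : v ∈ eigSp mul form e 0 ⊔ eigSp mul form e (δ : ℂ) ⊔ Submodule.span ℂ {e} :=
    he.2.2.2 ▸ Submodule.mem_top
  obtain ⟨_, hw, _, hz, rfl⟩ := Submodule.mem_sup.1 hv
  obtain ⟨v₀, h₀, v₁, h₁, rfl⟩ := Submodule.mem_sup.1 hw
  obtain ⟨c, rfl⟩ := Submodule.mem_span_singleton.1 hz
  refine ⟨c, v₀, h₀, v₁, h₁, by abel, ?_⟩
  rw [map_add, map_add, h₀.1, h₁.1, map_smul, smul_eq_mul, ← he.2.1]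
  ring

theorem IsSigma.apply_idem {σ : B ≃ₗ[ℂ] B} (hσ : IsSigma mul form (δ : ℂ) e σ) : σ e = e :=
  hσ.1 e (Submodule.mem_sup_right (Submodule.mem_span_singleton_self e))

theorem IsSigma.apply_zero {σ : B ≃ₗ[ℂ] B} (hσ : IsSigma mul form (δ : ℂ) e σ) {v : B}
    (hv : v ∈ eigSp mul form e 0) : σ v = v :=
  hσ.1 v (Submodule.mem_sup_left hv)

theorem IsSigma.apply_decomp {σ : B ≃ₗ[ℂ] B} (hσ : IsSigma mul form (δ : ℂ) e σ) (c : ℂ)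
    {v₀ v₁ : B} (h₀ : v₀ ∈ eigSp mul form e 0) (h₁ : v₁ ∈ eigSp mul form e (δ : ℂ)) :
    σ (c • e + v₀ + v₁) = c • e + v₀ - v₁ := by
  rw [map_add, map_add, map_smul, hσ.apply_idem, hσ.apply_zero h₀, hσ.2.1 _ h₁, sub_eq_add_neg]

theorem IsSigma.unique {σ τ : B ≃ₗ[ℂ] B} (he : memE mul form γ δ e)
    (hσ : IsSigma mul form (δ : ℂ) e σ) (hτ : IsSigma mul form (δ : ℂ) e τ) : σ = τ := by
  ext v
  obtain ⟨c, v₀, h₀, v₁, h₁, rfl, -⟩ := he.exists_decomp v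
  rw [hσ.apply_decomp c h₀ h₁, hτ.apply_decomp c h₀ h₁]

theorem IsSigma.mul_self {σ : B ≃ₗ[ℂ] B} (he : memE mul form γ δ e)
    (hσ : IsSigma mul form (δ : ℂ) e σ) : σ * σ = 1 := by
  ext v
  obtain ⟨c, v₀, h₀, v₁, h₁, rfl, -⟩ := he.exists_decomp v
  rw [LinearEquiv.mul_apply, hσ.apply_decomp c h₀ h₁, map_sub, map_add, map_smul,
    hσ.apply_idem, hσ.apply_zero h₀, hσ.2.1 _ h₁, sub_neg_eq_add]
  rfl

theorem memE.mul_decomp (he : memE mul form γ δ e) (c : ℂ) {v₀ v₁ : B}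
    (h₀ : v₀ ∈ eigSp mul form e 0) (h₁ : v₁ ∈ eigSp mul form e (δ : ℂ)) :
    mul e (c • e + v₀ + v₁) = (2 * c) • e + (δ : ℂ) • v₁ := by
  rw [map_add, map_add, map_smul, he.1, h₀.2, h₁.2]
  module

theorem memE.mul_mul_self (he : memE mul form γ δ e) {v : B} {c : ℂ} (hγ : 0 < γ)
    (hc : 2 * form e v = c * γ) :
    mul e (mul e v) = (δ : ℂ) • mul e v + (4 * c - 2 * c * δ) • e := by
  obtain ⟨d, v₀, h₀, v₁, h₁, rfl, hd⟩ := he.exists_decomp v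
  obtain rfl : c = d :=
    mul_right_cancel₀ (Complex.ofReal_ne_zero.2 hγ.ne') (hc.symm.trans hd)
  rw [he.mul_decomp c h₀ h₁, map_add, map_smul, map_smul, he.1, h₁.2]
  module

/-- The image of `v` under `σ_e`, expressed through the product `e·v`. -/
theorem IsSigma.smul_apply {σ : B ≃ₗ[ℂ] B} (he : memE mul form γ δ e)
    (hσ : IsSigma mul form (δ : ℂ) e σ) (hγ : 0 < γ) {v : B} {c : ℂ}
    (hc : 2 * form e v = c * γ) :
    (δ : ℂ) • σ v = (δ : ℂ) • v + (4 * c) • e - (2 : ℂ) • mul e v := by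
  obtain ⟨d, v₀, h₀, v₁, h₁, rfl, hd⟩ := he.exists_decomp v
  obtain rfl : c = d :=
    mul_right_cancel₀ (Complex.ofReal_ne_zero.2 hγ.ne') (hc.symm.trans hd)
  rw [he.mul_decomp c h₀ h₁, hσ.apply_decomp c h₀ h₁]
  module

/-- Two idempotents in `E` are either in the special position `(e|f) = δγ/8`,
or `σ_e` fixes `f`. -/
theorem IsSigma.apply_eq_self_or {σ : B ≃ₗ[ℂ] B} (hcomm : ∀ x y : B, mul x y = mul y x)
    (hsymm : ∀ x y : B, form x y = form y x) (hγ : 0 < γ) (hδ1 : δ ≠ 1)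
    (he : memE mul form γ δ e) (hf : memE mul form γ δ f)
    (hσ : IsSigma mul form (δ : ℂ) e σ) :
    σ f = f ∨ form e f = ((δ * γ / 8 : ℝ) : ℂ) := by
  obtain ⟨c, f₀, h₀, f₁, h₁, hdec, hc⟩ := he.exists_decomp f
  have hσf : σ f = c • e + f₀ - f₁ := by rw [hdec, hσ.apply_decomp c h₀ h₁]
  have hef : mul e f = (2 * c) • e + (δ : ℂ) • f₁ := by
    rw [hdec, he.mul_decomp c h₀ h₁]
  have hff := hf.1
  have hσff : mul (σ f) (σ f) = (2 : ℂ) • σ f := by rw [← hσ.2.2.1, hff, map_smul]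
  -- comparing the odd parts of `f·f = 2f`
  have hodd : mul f₀ f₁ = (1 - c * δ) • f₁ := by
    rw [hσf] at hσff
    rw [hdec] at hff
    simp only [map_add, map_sub, map_smul, LinearMap.add_apply, LinearMap.sub_apply,
      LinearMap.smul_apply, h₁.2, hcomm f₁ e, hcomm f₁ f₀] at hff hσff
    linear_combination (norm := module) (1 / 4 : ℂ) • hff - (1 / 4 : ℂ) • hσff
  have hrel := hf.mul_mul_self (v := e) hγ (by rw [hsymm]; exact hc)
  rw [hcomm f e, hef] at hrel
  have hmulf : mul f ((2 * c) • e + (δ : ℂ) • f₁) =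
      (2 * c) • ((2 * c) • e + (δ : ℂ) • f₁) + (δ : ℂ) • (f₁ + mul f₁ f₁) := by
    rw [map_add, map_smul, map_smul, hcomm f e, hef]
    nth_rw 1 [hdec]
    simp only [map_add, map_smul, LinearMap.add_apply, LinearMap.smul_apply, h₁.2, hodd]
    module
  rw [hmulf] at hrel
  have hσrel := congrArg σ hrel
  simp only [map_add, map_smul, hσ.2.2.1, hσ.2.1 _ h₁, hσ.apply_idem, hσf, map_neg,
    LinearMap.neg_apply, neg_neg] at hσrel
  have hkey : (((δ : ℂ) - 1) * (δ - 4 * c)) • f₁ = 0 := by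
    rw [hdec] at hrel
    linear_combination (norm := module) (1 / 2 : ℂ) • hσrel - (1 / 2 : ℂ) • hrel
  rcases smul_eq_zero.1 hkey with h | h
  · right
    have h1 : (δ : ℂ) - 1 ≠ 0 := sub_ne_zero.2 (by exact_mod_cast hδ1)
    have h2 := (mul_eq_zero.1 h).resolve_left h1
    push_cast
    linear_combination hc / 2 - h2 * γ / 8
  · left
    rw [hσf, hdec, h, sub_zero, add_zero]

theorem IsSigma.sq_eq_one {σ τ : B ≃ₗ[ℂ] B} (he : memE mul form γ δ e)
    (hf : memE mul form γ δ f) (hσ : IsSigma mul form (δ : ℂ) e σ)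
    (hτ : IsSigma mul form (δ : ℂ) f τ) (h : σ f = f) : (σ * τ) ^ 2 = 1 := by
  have hconj := IsSigma.conj hσ.2.2 hτ
  rw [h] at hconj
  calc (σ * τ) ^ 2 = (σ * τ * σ⁻¹) * (σ * σ) * τ := by rw [pow_two]; group
    _ = 1 := by rw [hconj.unique hf hτ, hσ.mul_self he, mul_one, hτ.mul_self hf]

theorem IsSigma.cube_eq_one {σ τ : B ≃ₗ[ℂ] B} (hcomm : ∀ x y : B, mul x y = mul y x)
    (hsymm : ∀ x y : B, form x y = form y x) (hγ : 0 < γ) (hδ : 0 < δ)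
    (he : memE mul form γ δ e) (hf : memE mul form γ δ f)
    (hσ : IsSigma mul form (δ : ℂ) e σ) (hτ : IsSigma mul form (δ : ℂ) f τ)
    (h : form e f = ((δ * γ / 8 : ℝ) : ℂ)) : (σ * τ) ^ 3 = 1 := by
  have hδ' : (δ : ℂ) ≠ 0 := Complex.ofReal_ne_zero.2 hδ.ne'
  have hc : 2 * form e f = ((δ : ℂ) / 4) * γ := by
    rw [h]
    push_cast
    ring
  have hswap : σ f = τ e := by
    have h1 := hσ.smul_apply he hγ hc
    have h2 := hτ.smul_apply hf hγ (v := e) (by rw [hsymm]; exact hc)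
    rw [hcomm f e] at h2
    refine smul_right_injective B hδ' (show (δ : ℂ) • σ f = (δ : ℂ) • τ e from ?_)
    rw [h1, h2]
    module
  have hconj := IsSigma.conj hσ.2.2 hτ
  rw [hswap] at hconj
  have hbraid := hconj.unique (PreservesStructure.map_memE hτ.2.2 he) (IsSigma.conj hτ.2.2 hσ)
  have hσσ := hσ.mul_self he
  have hττ := hτ.mul_self hf
  rw [inv_eq_of_mul_eq_one_right hσσ, inv_eq_of_mul_eq_one_right hττ] at hbraid
  calc (σ * τ) ^ 3 = (σ * τ * σ) * τ * σ * τ := by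
        simp only [pow_succ, pow_zero, one_mul, mul_assoc]
    _ = τ * σ * (τ * τ) * σ * τ := by simp only [hbraid, mul_assoc]
    _ = τ * (σ * σ) * τ := by simp only [hττ, mul_one, mul_assoc]
    _ = 1 := by rw [hσσ, mul_one, hττ]

end

/-- For any `e, f ∈ E` the automorphisms `σ_e, σ_f` satisfy: `σ_e σ_f` has
order `1`, `2` or `3`; more precisely if `e = f` then `σ_e σ_f = id`, if `(e|f) = 0` then
`(σ_e σ_f)² = id`, and if `(e|f) = δγ/8` then `(σ_e σ_f)³ = id`.  Consequently the pair
`(G, D)`, with `D = {σ_e : e ∈ E}` and `G = ⟨D⟩` (the closure of `D`) inside the group of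
form-preserving algebra automorphisms of `B`, is a 3-transposition group: `D` is a set of
involutions, stable under conjugation by `G`, and the order of `ab` is `1`, `2` or `3` for
all `a, b ∈ D`. -/
theorem stmt_7 {B : Type*} [AddCommGroup B] [Module ℂ B]
    (mul : B →ₗ[ℂ] B →ₗ[ℂ] B) (hcomm : ∀ x y : B, mul x y = mul y x)
    (form : B →ₗ[ℂ] B →ₗ[ℂ] ℂ) (hsymm : ∀ x y : B, form x y = form y x)
    (hinv : ∀ a x y : B, form (mul a x) y = form x (mul a y))
    (γ δ : ℝ) (hγ : 0 < γ) (hδ0 : 0 < δ) (hδ2 : δ < 2) (hδ1 : δ ≠ 1) :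
    (∀ (e f : B) (σe σf : B ≃ₗ[ℂ] B),
      memE mul form γ δ e → memE mul form γ δ f →
      IsSigma mul form (δ : ℂ) e σe → IsSigma mul form (δ : ℂ) f σf →
        ((e = f → σe * σf = 1) ∧
         (form e f = 0 → (σe * σf) ^ 2 = 1) ∧
         (form e f = ((δ * γ / 8 : ℝ) : ℂ) → (σe * σf) ^ 3 = 1) ∧
         (orderOf (σe * σf) = 1 ∨ orderOf (σe * σf) = 2 ∨ orderOf (σe * σf) = 3))) ∧
    (∀ σ ∈ setD mul form γ δ, σ * σ = 1) ∧
    (∀ g ∈ Subgroup.closure (setD mul form γ δ), ∀ σ ∈ setD mul form γ δ,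
      g * σ * g⁻¹ ∈ setD mul form γ δ) := by
  refine ⟨fun e f σe σf he hf hσ hτ => ?_, ?_, ?_⟩
  · have hdich := hσ.apply_eq_self_or hcomm hsymm hγ hδ1 he hf
    have hcube := hσ.cube_eq_one hcomm hsymm hγ hδ0 he hf hτ
    refine ⟨?_, fun h => ?_, hcube, ?_⟩
    · rintro rfl
      rw [hτ.unique he hσ, hσ.mul_self he]
    · refine hσ.sq_eq_one he hf hτ (hdich.resolve_right fun h' => ?_)
      rw [h] at h'
      have : (0 : ℝ) = δ * γ / 8 := by exact_mod_cast h'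
      exact absurd this (by positivity)
    · rcases hdich with h | h
      · have := (Nat.dvd_prime Nat.prime_two).1
          (orderOf_dvd_of_pow_eq_one (hσ.sq_eq_one he hf hτ h))
        tauto
      · have := (Nat.dvd_prime Nat.prime_three).1 (orderOf_dvd_of_pow_eq_one (hcube h))
        tauto
  · rintro σ ⟨e, he, hσ⟩
    exact hσ.mul_self he
  · rintro g hg σ ⟨e, he, hσ⟩
    have hg' := preservesStructure_of_mem_closure hg
    exact ⟨g e, hg'.map_memE he, IsSigma.conj hg' hσ⟩
end

section
/- Assume γ ≠ 0, δ ≠ 0 and δ ≠ 4. The bilinear form on B̃ is invariant with respect to the multiplication, i.e. (x̃·ỹ | z̃) = (ỹ | x̃·z̃) for all x, y, z ∈ X, if and only if X satisfies the following two conditions: (1) whenever x ∼ y and y ∼ z, the relation of x∘y to z (equality, ⊥, or ∼) is the same as the relation of x to y∘z; (2) whenever x ⊥ y, y ∼ z and z ⊥ x, one has x ⊥ (y∘z). -/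
/-- Let `X` be a set with a collinearity relation `∼`, third-point map `∘`,
and let `B̃` be the free `ℝ`-module on `X` with the multiplication and bilinear form
determined on the basis by the table of the paper (parameters `γ ≠ 0`, `δ ≠ 0`, `δ ≠ 4`).
The form is invariant, i.e. `(x̃·ỹ|z̃) = (ỹ|x̃·z̃)` for all `x, y, z ∈ X`, if and only if
(1) whenever `x ∼ y` and `y ∼ z`, the relation of `x∘y` to `z` is the same as the relation
of `x` to `y∘z`, and (2) whenever `x ⊥ y`, `y ∼ z` and `z ⊥ x`, one has `x ⊥ (y∘z)`. -/
theorem stmt_11 {X : Type*} (sim : X → X → Prop)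
    (hsymm : ∀ x y, sim x y → sim y x) (hirr : ∀ x, ¬ sim x x)
    (o : X → X → X)
    (ho_comm : ∀ x y, sim x y → o x y = o y x)
    (ho_simx : ∀ x y, sim x y → sim (o x y) x)
    (ho_simy : ∀ x y, sim x y → sim (o x y) y)
    (ho_nex : ∀ x y, sim x y → o x y ≠ x)
    (ho_ney : ∀ x y, sim x y → o x y ≠ y)
    (ho_inv : ∀ x y, sim x y → o (o x y) y = x)
    (γ δ : ℝ) (hγ : γ ≠ 0) (hδ : δ ≠ 0) (hδ4 : δ ≠ 4)
    (mul : (X →₀ ℝ) →ₗ[ℝ] (X →₀ ℝ) →ₗ[ℝ] (X →₀ ℝ))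
    (form : (X →₀ ℝ) →ₗ[ℝ] (X →₀ ℝ) →ₗ[ℝ] ℝ)
    (hm_diag : ∀ x, mul (Finsupp.single x 1) (Finsupp.single x 1)
      = (2 : ℝ) • Finsupp.single x 1)
    (hm_perp : ∀ x y, x ≠ y → ¬ sim x y →
      mul (Finsupp.single x 1) (Finsupp.single y 1) = 0)
    (hm_sim : ∀ x y, sim x y → mul (Finsupp.single x 1) (Finsupp.single y 1)
      = (δ / 2) • (Finsupp.single x 1 + Finsupp.single y 1 - Finsupp.single (o x y) 1))
    (hf_diag : ∀ x, form (Finsupp.single x 1) (Finsupp.single x 1) = γ / 2)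
    (hf_perp : ∀ x y, x ≠ y → ¬ sim x y →
      form (Finsupp.single x 1) (Finsupp.single y 1) = 0)
    (hf_sim : ∀ x y, sim x y →
      form (Finsupp.single x 1) (Finsupp.single y 1) = δ * γ / 8) :
    (∀ x y z : X,
        form (mul (Finsupp.single x 1) (Finsupp.single y 1)) (Finsupp.single z 1)
          = form (Finsupp.single y 1) (mul (Finsupp.single x 1) (Finsupp.single z 1))) ↔
    ((∀ x y z : X, sim x y → sim y z →
        ((o x y = z ↔ x = o y z) ∧ (sim (o x y) z ↔ sim x (o y z)))) ∧
     (∀ x y z : X, x ≠ y → ¬ sim x y → sim y z → z ≠ x → ¬ sim z x →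
        (x ≠ o y z ∧ ¬ sim x (o y z)))) := by
  obtain ⟨e, he⟩ : ∃ e : X → X →₀ ℝ, ∀ x, e x = Finsupp.single x 1 := ⟨_, fun _ => rfl⟩
  simp only [← he] at *
  have hsim_comm : ∀ x y, sim x y ↔ sim y x := fun x y => ⟨hsymm x y, hsymm y x⟩
  have hδγ : δ * γ / 8 ≠ 0 := by positivity
  have hγ2 : γ / 2 ≠ 0 := by positivity
  have hne : δ * γ / 8 ≠ γ / 2 := fun h =>
    hδ4 (mul_right_cancel₀ hγ (by linarith))
  have form_eq_iff : ∀ a b c d, form (e a) (e b) = form (e c) (e d) ↔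
      ((a = b ↔ c = d) ∧ (sim a b ↔ sim c d)) := by
    have value : ∀ a b, (a = b ∧ ¬ sim a b ∧ form (e a) (e b) = γ / 2) ∨
        (a ≠ b ∧ ¬ sim a b ∧ form (e a) (e b) = 0) ∨
        (a ≠ b ∧ sim a b ∧ form (e a) (e b) = δ * γ / 8) := by
      intro a b
      by_cases hab : a = b
      · subst hab
        exact .inl ⟨rfl, hirr a, hf_diag a⟩
      · by_cases h : sim a b
        · exact .inr (.inr ⟨hab, h, hf_sim a b h⟩)
        · exact .inr (.inl ⟨hab, h, hf_perp a b hab h⟩)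
    intro a b c d
    rcases value a b with ⟨h₁, h₂, h₃⟩ | ⟨h₁, h₂, h₃⟩ | ⟨h₁, h₂, h₃⟩ <;>
    rcases value c d with ⟨k₁, k₂, k₃⟩ | ⟨k₁, k₂, k₃⟩ | ⟨k₁, k₂, k₃⟩ <;>
    rw [h₃, k₃] <;> grind
  have form_comm : ∀ a b, form (e a) (e b) = form (e b) (e a) := fun a b =>
    (form_eq_iff a b b a).2 ⟨eq_comm, hsim_comm a b⟩
  have form_mul_left : ∀ x y z, sim x y → form (mul (e x) (e y)) (e z) =
      δ / 2 * (form (e x) (e z) + form (e y) (e z) - form (e (o x y)) (e z)) := by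
    intro x y z h
    simp [hm_sim x y h]
  have form_mul_right : ∀ x y z, sim y z → form (e x) (mul (e y) (e z)) =
      δ / 2 * (form (e x) (e y) + form (e x) (e z) - form (e x) (e (o y z))) := by
    intro x y z h
    simp [hm_sim y z h]
  have hδ2 : δ / 2 ≠ 0 := by positivity
  constructor
  · intro H
    refine ⟨fun x y z hxy hyz => ?_, fun x y z hxy nxy hyz hzx nzx => ?_⟩
    · rw [← form_eq_iff]
      have h := H y x z
      rw [form_mul_left y x z (hsymm x y hxy), form_mul_right x y z hyz,
        hf_sim x y hxy, hf_sim y z hyz, ← ho_comm x y hxy] at h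
      linarith [mul_left_cancel₀ hδ2 h]
    · have h := H y x z
      rw [hm_perp y x hxy.symm (fun h => nxy (hsymm y x h)), form_mul_right x y z hyz,
        hf_perp x y hxy nxy, form_comm x z, hf_perp z x hzx nzx] at h
      have h0 : form (e x) (e (o y z)) = form (e x) (e y) := by
        rw [hf_perp x y hxy nxy]
        simpa [hδ] using h
      have h1 := (form_eq_iff _ _ _ _).1 h0
      exact ⟨fun k => hxy (h1.1.1 k), fun k => nxy (h1.2.1 k)⟩
  · rintro ⟨H1, H2⟩
    have perp_line : ∀ x y z, x ≠ y → ¬ sim x y → sim y z →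
        form (e x) (mul (e y) (e z)) = 0 := by
      intro x y z hxy nxy hyz
      have hxz : x ≠ z := fun h => nxy (h ▸ hsymm y z hyz)
      have hw : sim y (o y z) := hsymm _ _ (ho_simx y z hyz)
      have hyw : o y (o y z) = z := by
        rw [ho_comm y _ hw, ho_comm y z hyz, ho_inv z y (hsymm y z hyz)]
      have hxw : x ≠ o y z := fun h => nxy (hsymm _ _ (h ▸ hw))
      have key : form (e x) (e z) = form (e x) (e (o y z)) := by
        rw [form_eq_iff]
        refine ⟨iff_of_false hxz hxw, ?_, ?_⟩
        · intro h
          by_contra hn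
          have := (H2 x y (o y z) hxy nxy hw hxw.symm (fun k => hn (hsymm _ _ k))).2
          rw [hyw] at this
          exact this h
        · intro h
          by_contra hn
          exact (H2 x y z hxy nxy hyz hxz.symm (fun k => hn (hsymm _ _ k))).2 h
      rw [form_mul_right x y z hyz, hf_perp x y hxy nxy, key]
      ring
    have form_mul_comm : ∀ x y z, sim x y →
        form (mul (e x) (e y)) (e z) = form (e z) (mul (e x) (e y)) := by
      intro x y z h
      rw [form_mul_left x y z h, form_mul_right z x y h, form_comm x z, form_comm y z,
        form_comm (o x y) z]
    have diag : ∀ x z, form (mul (e x) (e x)) (e z) = form (e x) (mul (e x) (e z)) := by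
      intro x z
      by_cases hxz : x = z
      · subst hxz
        simp [hm_diag]
      by_cases h : sim x z
      · rw [form_mul_right x x z h, hm_diag, hf_diag, hf_sim x z h,
          hf_sim x _ (hsymm _ _ (ho_simx x z h))]
        simp [hf_sim x z h]
        ring
      · simp [hm_diag, hm_perp x z hxz h, hf_perp x z hxz h]
    have form_comm_diag : ∀ x z, form (mul (e x) (e x)) (e z) = form (e z) (mul (e x) (e x)) := by
      intro x z
      simp [hm_diag, form_comm x z]
    intro x y z
    by_cases hxy : x = y
    · subst hxy
      exact diag x z
    by_cases hxz : x = z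
    · subst hxz
      rw [← form_comm_diag, diag]
      by_cases h : sim x y
      · exact form_mul_comm x y x h
      · simp [hm_perp x y hxy h]
    by_cases h : sim x y
    · by_cases k : sim x z
      · have h' := hsymm x y h
        rw [form_mul_left x y z h, form_mul_right y x z k, hf_sim x z k, hf_sim y x h',
          ho_comm x y h, (form_eq_iff _ _ _ _).2 (H1 y x z h' k)]
      · rw [form_mul_comm x y z h, hm_perp x z hxz k,
          perp_line z x y (Ne.symm hxz) (fun q => k (hsymm _ _ q)) h, map_zero]
    · rw [hm_perp x y hxy h]
      by_cases k : sim x z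
      · rw [perp_line y x z (Ne.symm hxy) (fun q => h (hsymm _ _ q)) k]
        simp
      · simp [hm_perp x z hxz k]
end

section
/- Assume X is finite and every point of X is collinear with exactly k points, and 4 + kδ ≠ 0. Then the element ω̃ = (4/(4+kδ)) Σ_{x∈X} x̃ of B̃ satisfies ω̃·ỹ = 2ỹ for every y ∈ X; hence ω̃ is twice the unity of the algebra B̃. -/
/-- Assume `X` is finite, every point of `X` is collinear with exactly `k`
points, and `4 + kδ ≠ 0`.  Then `ω̃ = (4/(4+kδ)) Σ_{x∈X} x̃` satisfies `ω̃·ỹ = 2ỹ` for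
every `y ∈ X`; hence `ω̃` is twice the unity of the algebra `B̃`. -/
theorem stmt_12 {X : Type*} [Fintype X] (sim : X → X → Prop)
    (hsymm : ∀ x y, sim x y → sim y x) (hirr : ∀ x, ¬ sim x x)
    (o : X → X → X)
    (ho_comm : ∀ x y, sim x y → o x y = o y x)
    (ho_simx : ∀ x y, sim x y → sim (o x y) x)
    (ho_simy : ∀ x y, sim x y → sim (o x y) y)
    (ho_nex : ∀ x y, sim x y → o x y ≠ x)
    (ho_ney : ∀ x y, sim x y → o x y ≠ y)
    (ho_inv : ∀ x y, sim x y → o (o x y) y = x)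
    (γ δ : ℝ)
    (k : ℕ) (hk : ∀ x : X, Nat.card {y : X // sim x y} = k)
    (hkδ : (4 : ℝ) + k * δ ≠ 0)
    (mul : (X →₀ ℝ) →ₗ[ℝ] (X →₀ ℝ) →ₗ[ℝ] (X →₀ ℝ))
    (hm_diag : ∀ x, mul (Finsupp.single x 1) (Finsupp.single x 1)
      = (2 : ℝ) • Finsupp.single x 1)
    (hm_perp : ∀ x y, x ≠ y → ¬ sim x y →
      mul (Finsupp.single x 1) (Finsupp.single y 1) = 0)
    (hm_sim : ∀ x y, sim x y → mul (Finsupp.single x 1) (Finsupp.single y 1)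
      = (δ / 2) • (Finsupp.single x 1 + Finsupp.single y 1 - Finsupp.single (o x y) 1)) :
    ∀ y : X,
      mul ((4 / (4 + k * δ)) • ∑ x : X, Finsupp.single x (1 : ℝ)) (Finsupp.single y 1)
        = (2 : ℝ) • Finsupp.single y 1 := by
  classical
  intro y
  have hterm : ∀ x, mul (Finsupp.single x 1) (Finsupp.single y 1)
      = (if x = y then (2 : ℝ) • Finsupp.single y (1 : ℝ) else 0)
        + (if sim x y then (δ / 2) • (Finsupp.single x (1 : ℝ) + Finsupp.single y 1
            - Finsupp.single (o x y) 1) else 0) := by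
    intro x
    by_cases hxy : x = y
    · subst hxy
      simp only [hm_diag, if_true, if_neg (hirr x), add_zero]
    · by_cases hs : sim x y
      · simp only [hm_sim x y hs, if_neg hxy, if_pos hs, zero_add]
      · simp only [hm_perp x y hxy hs, if_neg hxy, if_neg hs, zero_add]
  have hinv : ∑ x with sim x y, Finsupp.single (o x y) (1 : ℝ)
      = ∑ x with sim x y, Finsupp.single x (1 : ℝ) := by
    refine Finset.sum_nbij' (fun x => o x y) (fun x => o x y) ?_ ?_ ?_ ?_ ?_
    · intro x hx
      simpa using ho_simy x y (by simpa using hx)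
    · intro x hx
      simpa using ho_simy x y (by simpa using hx)
    · intro x hx
      exact ho_inv x y (by simpa using hx)
    · intro x hx
      exact ho_inv x y (by simpa using hx)
    · intro x _
      rfl
  have hcard : (Finset.univ.filter (fun x => sim x y)).card = k := by
    rw [← hk y, Nat.card_eq_fintype_card, Fintype.card_subtype]
    congr 1
    ext x
    simp only [Finset.mem_filter, Finset.mem_univ, true_and]
    exact ⟨hsymm x y, hsymm y x⟩
  have hsum : ∑ x, mul (Finsupp.single x 1) (Finsupp.single y 1)
      = (2 + k * δ / 2) • Finsupp.single y (1 : ℝ) := by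
    rw [Finset.sum_congr rfl fun x _ => hterm x, Finset.sum_add_distrib,
      Finset.sum_ite_eq' Finset.univ y, if_pos (Finset.mem_univ y), ← Finset.sum_filter,
      ← Finset.smul_sum, Finset.sum_sub_distrib, Finset.sum_add_distrib, hinv,
      Finset.sum_const, hcard, ← Nat.cast_smul_eq_nsmul ℝ]
    module
  rw [map_smul, LinearMap.smul_apply, map_sum, LinearMap.sum_apply, hsum, smul_smul]
  congr 1
  field_simp
  ring
end

section
/- Let γ, δ be scalars with 2 + δ ≠ 0. In the 3-dimensional algebra B̃ on basis e₁, e₂, e₃ with multiplication eᵢ·eᵢ = 2eᵢ and eᵢ·eⱼ = (δ/2)(eᵢ + eⱼ − e_k) for {i,j,k} = {1,2,3}, and symmetric bilinear form (eᵢ|eᵢ) = γ/2, (eᵢ|eⱼ) = δγ/8 for i ≠ j, set ω = (4/(4+2δ))(e₁ + e₂ + e₃) and η = ω − e₁. Then ω·x = 2x for all x ∈ B̃, η·η = 2η, η·e₁ = 0, and 2(η|η) = (4 − δ)γ/(2 + δ). In particular for γ = δ = 1/2 one gets 2(e₁|e₁) = 1/2 and 2(η|η) = 7/10. -/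
/-- In the 3-dimensional algebra `B̃` on a basis `e₁, e₂, e₃` with
`eᵢ·eᵢ = 2eᵢ`, `eᵢ·eⱼ = (δ/2)(eᵢ + eⱼ − e_k)` for `{i,j,k} = {1,2,3}`, and form
`(eᵢ|eᵢ) = γ/2`, `(eᵢ|eⱼ) = δγ/8` for `i ≠ j`, set `ω = (4/(4+2δ))(e₁+e₂+e₃)` and
`η = ω − e₁`.  Then `ω·x = 2x` for all `x`, `η·η = 2η`, `η·e₁ = 0`, and
`2(η|η) = (4 − δ)γ/(2 + δ)`.  In particular for `γ = δ = 1/2` one gets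
`2(e₁|e₁) = 1/2` and `2(η|η) = 7/10`. -/
theorem stmt_16 (γ δ : ℝ) (hδ : 2 + δ ≠ 0)
    {B : Type*} [AddCommGroup B] [Module ℝ B]
    (mul : B →ₗ[ℝ] B →ₗ[ℝ] B) (hcomm : ∀ x y : B, mul x y = mul y x)
    (form : B →ₗ[ℝ] B →ₗ[ℝ] ℝ) (hsymm : ∀ x y : B, form x y = form y x)
    (e : Fin 3 → B) (hli : LinearIndependent ℝ e)
    (hspan : Submodule.span ℝ (Set.range e) = ⊤)
    (hm_diag : ∀ i, mul (e i) (e i) = (2 : ℝ) • e i)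
    (hm_off : ∀ i j k : Fin 3, i ≠ j → j ≠ k → i ≠ k →
      mul (e i) (e j) = (δ / 2) • (e i + e j - e k))
    (hf_diag : ∀ i, form (e i) (e i) = γ / 2)
    (hf_off : ∀ i j : Fin 3, i ≠ j → form (e i) (e j) = δ * γ / 8) :
    (∀ x : B, mul ((4 / (4 + 2 * δ)) • (e 0 + e 1 + e 2)) x = (2 : ℝ) • x) ∧
    mul ((4 / (4 + 2 * δ)) • (e 0 + e 1 + e 2) - e 0)
        ((4 / (4 + 2 * δ)) • (e 0 + e 1 + e 2) - e 0)
      = (2 : ℝ) • ((4 / (4 + 2 * δ)) • (e 0 + e 1 + e 2) - e 0) ∧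
    mul ((4 / (4 + 2 * δ)) • (e 0 + e 1 + e 2) - e 0) (e 0) = 0 ∧
    2 * form ((4 / (4 + 2 * δ)) • (e 0 + e 1 + e 2) - e 0)
        ((4 / (4 + 2 * δ)) • (e 0 + e 1 + e 2) - e 0)
      = (4 - δ) * γ / (2 + δ) ∧
    (γ = 1 / 2 → δ = 1 / 2 →
      2 * form (e 0) (e 0) = 1 / 2 ∧
      2 * form ((4 / (4 + 2 * δ)) • (e 0 + e 1 + e 2) - e 0)
          ((4 / (4 + 2 * δ)) • (e 0 + e 1 + e 2) - e 0) = 7 / 10) := by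
  have h4 : 4 + 2 * δ ≠ 0 := by
    intro h
    exact hδ (by linarith)
  have hc : (4 / (4 + 2 * δ)) * (2 + δ) = 2 := by
    field_simp
    ring
  have hω_diag : ∀ i j k : Fin 3, i ≠ j → j ≠ k → i ≠ k →
      mul (e i + e j + e k) (e i) = (2 + δ) • e i := by
    intro i j k hij hjk hik
    simp only [map_add, LinearMap.add_apply, hm_diag, hm_off j i k hij.symm hik hjk,
      hm_off k i j hik.symm hij hjk.symm]
    module
  have hω_basis : ∀ i, mul (e 0 + e 1 + e 2) (e i) = (2 + δ) • e i := by
    intro i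
    fin_cases i
    · exact hω_diag 0 1 2 (by decide) (by decide) (by decide)
    · rw [add_comm (e 0)]
      exact hω_diag 1 0 2 (by decide) (by decide) (by decide)
    · rw [add_comm (e 0 + e 1), ← add_assoc]
      exact hω_diag 2 0 1 (by decide) (by decide) (by decide)
  have hω : ∀ x : B, mul ((4 / (4 + 2 * δ)) • (e 0 + e 1 + e 2)) x = (2 : ℝ) • x := by
    have hext : mul ((4 / (4 + 2 * δ)) • (e 0 + e 1 + e 2)) = (2 : ℝ) • LinearMap.id := by
      refine LinearMap.ext_on_range hspan fun i => ?_
      rw [map_smul, LinearMap.smul_apply, hω_basis, smul_smul, hc]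
      simp
    intro x
    rw [hext, LinearMap.smul_apply, LinearMap.id_apply]
  have hη_e : mul ((4 / (4 + 2 * δ)) • (e 0 + e 1 + e 2) - e 0) (e 0) = 0 := by
    rw [map_sub, LinearMap.sub_apply, hω, hm_diag, sub_self]
  have hη_form : 2 * form ((4 / (4 + 2 * δ)) • (e 0 + e 1 + e 2) - e 0)
      ((4 / (4 + 2 * δ)) • (e 0 + e 1 + e 2) - e 0) = (4 - δ) * γ / (2 + δ) := by
    simp only [map_sub, map_add, map_smul, LinearMap.sub_apply, LinearMap.add_apply,
      LinearMap.smul_apply, smul_eq_mul, hf_diag, hf_off 0 1 (by decide),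
      hf_off 0 2 (by decide), hf_off 1 0 (by decide), hf_off 1 2 (by decide),
      hf_off 2 0 (by decide), hf_off 2 1 (by decide)]
    have hc' : 4 / (4 + 2 * δ) = 2 / (2 + δ) := by
      field_simp
      ring
    rw [hc']
    field_simp
    ring
  refine ⟨hω, ?_, hη_e, hη_form, ?_⟩
  · rw [map_sub (mul _), hη_e, sub_zero, hcomm, hω]
  · rintro rfl rfl
    refine ⟨?_, ?_⟩
    · rw [hf_diag]
      norm_num
    · rw [hη_form]
      norm_num
end

section
/- Let B̃ be the 9-dimensional real algebra with basis {e_x : x ∈ (ℤ/3ℤ)²}, multiplication e_x·e_x = 2e_x and e_x·e_y = (1/4)(e_x + e_y − e_{−x−y}) for x ≠ y, and symmetric bilinear form (e_x|e_x) = 1/4, (e_x|e_y) = 1/32 for x ≠ y (the algebra of the affine plane of order 3 with parameters γ = 1/2, δ = 1/2). Set η = (4/5)(e_{(0,0)} + e_{(0,1)} + e_{(0,2)}) − e_{(0,0)} and w = e_{(1,0)} + e_{(1,1)} + e_{(1,2)} − e_{(2,0)} − e_{(2,1)} − e_{(2,2)}. Then η·η = 2η, 2(η|η) = 7/10, w ≠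 0, and η·w = (7/10)·w; that is, w is a nonzero eigenvector of the adjoint action of the idempotent η with eigenvalue 7/10. -/
/-- The basis vector `e_x` of the algebra of the affine plane of order 3,
for `x = (a, b) ∈ (ℤ/3ℤ)²`. -/
noncomputable def planePt (a b : ZMod 3) : (ZMod 3 × ZMod 3) →₀ ℝ :=
  Finsupp.single (a, b) 1

/-- The idempotent `η = (4/5)(e_{(0,0)} + e_{(0,1)} + e_{(0,2)}) − e_{(0,0)}`. -/
noncomputable def planeEta : (ZMod 3 × ZMod 3) →₀ ℝ :=
  (4 / 5 : ℝ) • (planePt 0 0 + planePt 0 1 + planePt 0 2) - planePt 0 0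

/-- The vector `w = e_{(1,0)} + e_{(1,1)} + e_{(1,2)} − e_{(2,0)} − e_{(2,1)} − e_{(2,2)}`. -/
noncomputable def planeW : (ZMod 3 × ZMod 3) →₀ ℝ :=
  planePt 1 0 + planePt 1 1 + planePt 1 2 - planePt 2 0 - planePt 2 1 - planePt 2 2

/-- In the 9-dimensional real algebra `B̃` of the affine plane of order 3
(parameters `γ = δ = 1/2`), with `η` and `w` as above, one has `η·η = 2η`,
`2(η|η) = 7/10`, `w ≠ 0`, and `η·w = (7/10)·w`; i.e. `w` is a nonzero eigenvector of the
adjoint action of the idempotent `η` with eigenvalue `7/10`. -/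
theorem stmt_17
    (mul : ((ZMod 3 × ZMod 3) →₀ ℝ) →ₗ[ℝ] ((ZMod 3 × ZMod 3) →₀ ℝ) →ₗ[ℝ]
      ((ZMod 3 × ZMod 3) →₀ ℝ))
    (form : ((ZMod 3 × ZMod 3) →₀ ℝ) →ₗ[ℝ] ((ZMod 3 × ZMod 3) →₀ ℝ) →ₗ[ℝ] ℝ)
    (hm_diag : ∀ x : ZMod 3 × ZMod 3,
      mul (Finsupp.single x 1) (Finsupp.single x 1) = (2 : ℝ) • Finsupp.single x 1)
    (hm_off : ∀ x y : ZMod 3 × ZMod 3, x ≠ y →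
      mul (Finsupp.single x 1) (Finsupp.single y 1)
        = (1 / 4 : ℝ) • (Finsupp.single x 1 + Finsupp.single y 1 - Finsupp.single (-x - y) 1))
    (hf_diag : ∀ x : ZMod 3 × ZMod 3,
      form (Finsupp.single x 1) (Finsupp.single x 1) = 1 / 4)
    (hf_off : ∀ x y : ZMod 3 × ZMod 3, x ≠ y →
      form (Finsupp.single x 1) (Finsupp.single y 1) = 1 / 32) :
    mul planeEta planeEta = (2 : ℝ) • planeEta ∧
    2 * form planeEta planeEta = 7 / 10 ∧
    planeW ≠ 0 ∧
    mul planeEta planeW = (7 / 10 : ℝ) • planeW := by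
  have sq (a b : ZMod 3) : mul (planePt a b) (planePt a b) = (2 : ℝ) • planePt a b :=
    hm_diag (a, b)
  have prod (a b c d : ZMod 3) (h : (a, b) ≠ (c, d)) : mul (planePt a b) (planePt c d)
      = (1 / 4 : ℝ) • (planePt a b + planePt c d - planePt (-a - c) (-b - d)) :=
    hm_off (a, b) (c, d) h
  have norm_sq (a b : ZMod 3) : form (planePt a b) (planePt a b) = 1 / 4 := hf_diag (a, b)
  have inner_eq (a b c d : ZMod 3) (h : (a, b) ≠ (c, d)) :
      form (planePt a b) (planePt c d) = 1 / 32 := hf_off (a, b) (c, d) h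
  refine ⟨?_, ?_, ?_, ?_⟩
  · simp (disch := decide) only [planeEta, map_add, map_sub, map_smul, LinearMap.add_apply,
      LinearMap.sub_apply, LinearMap.smul_apply, sq, prod]
    reduce_mod_char
    module
  · simp (disch := decide) only [planeEta, map_add, map_sub, map_smul, LinearMap.add_apply,
      LinearMap.sub_apply, LinearMap.smul_apply, norm_sq, inner_eq, smul_eq_mul]
    norm_num
  · intro h
    have h₁ : planeW (1, 0) = 1 := by
      simp +decide [planeW, planePt]
    simp [h] at h₁
  · simp (disch := decide) only [planeEta, planeW, map_add, map_sub, map_smul,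
      LinearMap.add_apply, LinearMap.sub_apply, LinearMap.smul_apply, prod]
    reduce_mod_char
    module
end

section
/- Assume every two distinct points of X are collinear (i.e. X is a Steiner triple system: the relation ∼ holds for all x ≠ y). Then the bilinear form on B̃ is invariant with respect to the multiplication: (x̃·ỹ | z̃) = (ỹ | x̃·z̃) for all x, y, z ∈ X. -/
/-- Assume every two distinct points of `X` are collinear (i.e. `X` is a
Steiner triple system).  Then the bilinear form on `B̃` is invariant with respect to the
multiplication: `(x̃·ỹ|z̃) = (ỹ|x̃·z̃)` for all `x, y, z ∈ X`. -/
theorem stmt_19 {X : Type*} (sim : X → X → Prop)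
    (hsymm : ∀ x y, sim x y → sim y x) (hirr : ∀ x, ¬ sim x x)
    (o : X → X → X)
    (ho_comm : ∀ x y, sim x y → o x y = o y x)
    (ho_simx : ∀ x y, sim x y → sim (o x y) x)
    (ho_simy : ∀ x y, sim x y → sim (o x y) y)
    (ho_nex : ∀ x y, sim x y → o x y ≠ x)
    (ho_ney : ∀ x y, sim x y → o x y ≠ y)
    (ho_inv : ∀ x y, sim x y → o (o x y) y = x)
    (hall : ∀ x y : X, x ≠ y → sim x y)
    (γ δ : ℝ)
    (mul : (X →₀ ℝ) →ₗ[ℝ] (X →₀ ℝ) →ₗ[ℝ] (X →₀ ℝ))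
    (form : (X →₀ ℝ) →ₗ[ℝ] (X →₀ ℝ) →ₗ[ℝ] ℝ)
    (hm_diag : ∀ x, mul (Finsupp.single x 1) (Finsupp.single x 1)
      = (2 : ℝ) • Finsupp.single x 1)
    (hm_perp : ∀ x y, x ≠ y → ¬ sim x y →
      mul (Finsupp.single x 1) (Finsupp.single y 1) = 0)
    (hm_sim : ∀ x y, sim x y → mul (Finsupp.single x 1) (Finsupp.single y 1)
      = (δ / 2) • (Finsupp.single x 1 + Finsupp.single y 1 - Finsupp.single (o x y) 1))
    (hf_diag : ∀ x, form (Finsupp.single x 1) (Finsupp.single x 1) = γ / 2)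
    (hf_perp : ∀ x y, x ≠ y → ¬ sim x y →
      form (Finsupp.single x 1) (Finsupp.single y 1) = 0)
    (hf_sim : ∀ x y, sim x y →
      form (Finsupp.single x 1) (Finsupp.single y 1) = δ * γ / 8) :
    ∀ x y z : X,
      form (mul (Finsupp.single x 1) (Finsupp.single y 1)) (Finsupp.single z 1)
        = form (Finsupp.single y 1) (mul (Finsupp.single x 1) (Finsupp.single z 1)) := by
  have third_eq : ∀ x y z, x ≠ y → o x y = z → o x z = y := by
    rintro x y _ hxy rfl
    have h := hall x y hxy
    rw [← ho_comm _ _ (ho_simx x y h), ho_comm x y h]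
    exact ho_inv y x (hsymm x y h)
  have form_ne : ∀ x y, x ≠ y →
      form (Finsupp.single x 1) (Finsupp.single y 1) = δ * γ / 8 :=
    fun x y h => hf_sim x y (hall x y h)
  have mul_ne : ∀ x y, x ≠ y → mul (Finsupp.single x 1) (Finsupp.single y 1)
      = (δ / 2) • (Finsupp.single x 1 + Finsupp.single y 1 - Finsupp.single (o x y) 1) :=
    fun x y h => hm_sim x y (hall x y h)
  have third_ne_left : ∀ x y, x ≠ y → o x y ≠ x := fun x y h => ho_nex x y (hall x y h)
  intro x y z
  by_cases hxy : x = y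
  · subst hxy
    by_cases hxz : x = z
    · subst hxz
      simp only [hm_diag, map_smul, LinearMap.smul_apply]
    · simp only [hm_diag, mul_ne x z hxz, map_smul, map_add, map_sub, LinearMap.smul_apply,
        smul_eq_mul, hf_diag, form_ne x z hxz, form_ne x _ (third_ne_left x z hxz).symm]
      ring
  by_cases hxz : x = z
  · subst hxz
    simp only [hm_diag, mul_ne x y hxy, map_smul, map_add, map_sub, LinearMap.smul_apply,
      LinearMap.add_apply, LinearMap.sub_apply, smul_eq_mul, hf_diag,
      form_ne y x (Ne.symm hxy), form_ne _ x (third_ne_left x y hxy)]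
    ring
  have form_third : form (Finsupp.single (o x y) 1) (Finsupp.single z 1)
      = form (Finsupp.single y 1) (Finsupp.single (o x z) 1) := by
    by_cases h : o x y = z
    · rw [third_eq x y z hxy h, h, hf_diag, hf_diag]
    · rw [form_ne _ _ h, form_ne _ _ fun h' => h (third_eq x z y hxz h'.symm)]
  simp only [mul_ne x y hxy, mul_ne x z hxz, map_smul, map_add, map_sub, LinearMap.smul_apply,
    LinearMap.add_apply, LinearMap.sub_apply, smul_eq_mul, form_third,
    form_ne x z hxz, form_ne y x (Ne.symm hxy)]
end
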